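/- Local Hausdorff-measure bound for a manifold with reach bounded below (inequality (proof.upper.volume.bound) in the proof of Claim B.1): Fix integers 1 ≤ d ≤ m and a real K_I ≥ 1. There exists a constant C ∈ (0,∞), depending only on K_I, d and m, such that for every τ_g ∈ (0,∞), every compact topological d-manifold with boundary M ⊆ [−K_I, K_I]^m having reach at least τ_g, every x ∈ ℝ^m and every s > 0: H^d(M ∩ closed ball of center x and radius s) ≤ C · (1 + τ_g^{d−m}) · s^{d}. -/

import Mathlib

open MeasureTheory Metric Set

noncomputable section

/-- `M ⊆ E` has reach at least `τ`: every point at distance `< τ` from `M`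
has a unique nearest point in `M`. -/
def HasReachGE {E : Type*} [MetricSpace E] (M : Set E) (τ : ℝ) : Prop :=
  ∀ x : E, Metric.infDist x M < τ →
    ∃! y, y ∈ M ∧ dist x y = Metric.infDist x M

/-- `M` has local reach at least `τ`: every `p ∈ M` has a neighborhood of `p`
in `M` with reach at least `τ`. -/
def HasLocalReachGE {E : Type*} [MetricSpace E] (M : Set E) (τ : ℝ) : Prop :=
  ∀ p ∈ M, ∃ U : Set E, U ⊆ M ∧ U ∈ nhdsWithin p M ∧ HasReachGE U τ

/-- `M` is a compact topological `d`-manifold with boundary: `M` is compact and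
every point of `M` has an open neighborhood in `M` homeomorphic to an open subset
of the half-space `[0,∞) × ℝ^{d-1}`. -/
def IsCompactTopManifoldWithBoundary {E : Type*} [TopologicalSpace E] (d : ℕ)
    (M : Set E) : Prop :=
  IsCompact M ∧
  ∀ p : M, ∃ U : Set M, IsOpen U ∧ p ∈ U ∧
    ∃ V : Set {x : ℝ × EuclideanSpace ℝ (Fin (d - 1)) // 0 ≤ x.1},
      IsOpen V ∧ Nonempty (U ≃ₜ V)

/-- The cube `[-K, K]^m` in `ℝ^m`. -/
def cube (m : ℕ) (K : ℝ) : Set (EuclideanSpace ℝ (Fin m)) := {x | ∀ i, |x i| ≤ K}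

/-- `P` is supported on `M` with density at most `Kp` with respect to the
`d`-dimensional Hausdorff measure. -/
def SupportedWithDensityLE {m : ℕ} (P : Measure (EuclideanSpace ℝ (Fin m)))
    (M : Set (EuclideanSpace ℝ (Fin m))) (d : ℕ) (Kp : ℝ) : Prop :=
  P M = 1 ∧ ∀ A : Set (EuclideanSpace ℝ (Fin m)), MeasurableSet A →
    P A ≤ ENNReal.ofReal Kp * μH[(d : ℝ)] (A ∩ M)

/-- The `n`-fold product measure `P^{(n)}` on `(ℝ^m)^n`. -/
def prodMeasure {m : ℕ} (n : ℕ) (P : Measure (EuclideanSpace ℝ (Fin m))) :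
    Measure (Fin n → EuclideanSpace ℝ (Fin m)) :=
  Measure.pi fun _ => P


open Filter Topology

/-- The determinant `det (1 + t A)` is a polynomial in `t` of degree at most the dimension. -/
theorem exists_polynomial_eval_eq_det_one_add_smul {E : Type*} [NormedAddCommGroup E]
    [NormedSpace ℝ E] [FiniteDimensional ℝ E] (A : E →L[ℝ] E) :
    ∃ P : Polynomial ℝ, P.natDegree ≤ Module.finrank ℝ E ∧
      ∀ t : ℝ, P.eval t = (1 + t • A).det := by
  let b := Module.finBasis ℝ E
  let M := LinearMap.toMatrix b b (A : E →ₗ[ℝ] E)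
  refine ⟨((Polynomial.X : Polynomial ℝ) • M.map (Polynomial.C : ℝ →+* Polynomial ℝ) +
    (1 : Matrix (Fin (Module.finrank ℝ E)) (Fin (Module.finrank ℝ E)) ℝ).map
      (Polynomial.C : ℝ →+* Polynomial ℝ)).det,
    ?_, fun t => ?_⟩
  · simpa using Polynomial.natDegree_det_X_add_C_le M 1
  · have h1 : (1 + t • A).det = (LinearMap.toMatrix b b ((1 + t • A : E →L[ℝ] E) : E →ₗ[ℝ] E)).det :=
      (LinearMap.det_toMatrix b _).symm
    have h2 : LinearMap.toMatrix b b ((1 + t • A : E →L[ℝ] E) : E →ₗ[ℝ] E) = 1 + t • M := by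
      have : ((1 + t • A : E →L[ℝ] E) : E →ₗ[ℝ] E) = LinearMap.id + t • (A : E →ₗ[ℝ] E) := rfl
      rw [this, map_add, map_smul, LinearMap.toMatrix_id]
    rw [h1, h2, ← Polynomial.coe_evalRingHom, RingHom.map_det]
    congr 1
    ext i j
    by_cases hij : i = j
    · simp [hij, add_comm]; exact mul_comm _ _
    · simp [hij]; exact mul_comm _ _

/-- Extrapolation to `1` of polynomials of bounded degree from nodes in `(0, ε)`. -/
theorem exists_extrapolation_weights (n : ℕ) {ε : ℝ} (hε : 0 < ε) :
    ∃ w t : Fin (n + 1) → ℝ, (∀ i, 0 < t i ∧ t i < ε) ∧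
      ∀ P : Polynomial ℝ, P.natDegree ≤ n → P.eval 1 = ∑ i, w i * P.eval (t i) := by
  let t : Fin (n + 1) → ℝ := fun i => ε * ((i : ℝ) + 1) / (n + 2)
  have ht : Function.Injective t := by
    intro i j hij
    have h2 : (0 : ℝ) < n + 2 := by positivity
    simp only [t] at hij
    have := (div_left_inj' h2.ne').1 hij
    have := mul_left_cancel₀ hε.ne' this
    apply Fin.ext
    exact_mod_cast add_right_cancel this
  refine ⟨fun i => (Lagrange.basis Finset.univ t i).eval 1, t, fun i => ⟨by positivity, ?_⟩, ?_⟩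
  · simp only [t]
    have h2 : (0 : ℝ) < n + 2 := by positivity
    rw [div_lt_iff₀ h2]
    have : (i : ℝ) ≤ n := by exact_mod_cast Nat.lt_succ_iff.1 i.2
    nlinarith
  · intro P hP
    have hdeg : P.degree < (Finset.univ : Finset (Fin (n + 1))).card := by
      refine lt_of_le_of_lt Polynomial.degree_le_natDegree ?_
      simp only [Finset.card_univ, Fintype.card_fin]
      exact_mod_cast Nat.lt_succ_of_le hP
    have := Lagrange.eq_interpolate (v := t) (s := Finset.univ) ht.injOn hdeg
    conv_lhs => rw [this]
    rw [Lagrange.interpolate_apply, Polynomial.eval_finsetSum]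
    refine Finset.sum_congr rfl fun i _ => ?_
    rw [Polynomial.eval_mul, Polynomial.eval_C, mul_comm]

/-- If `φ` is Lipschitz, vanishes outside the unit ball and is differentiable inside it, then
the Jacobian determinant of `id + φ` integrates over the unit ball to the volume of the ball. -/
theorem integral_det_one_add_fderiv_eq {E : Type*} [NormedAddCommGroup E]
    [NormedSpace ℝ E] [FiniteDimensional ℝ E] [MeasurableSpace E] [BorelSpace E]
    (μ : Measure E) [μ.IsAddHaarMeasure] {φ : E → E} {K : NNReal} (hφ : LipschitzWith K φ)
    (hφ0 : ∀ x, 1 ≤ ‖x‖ → φ x = 0) (hd : ∀ x ∈ ball (0 : E) 1, DifferentiableAt ℝ φ x) :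
    ∫ x in ball (0 : E) 1, (1 + fderiv ℝ φ x).det ∂μ = μ.real (ball 0 1) := by
  obtain ⟨ε₀, hε₀, hdet⟩ : ∃ ε > 0, ∀ A : E →L[ℝ] E, ‖A‖ < ε → 0 < (1 + A).det := by
    have hc : Continuous fun A : E →L[ℝ] E => (1 + A).det :=
      ContinuousLinearMap.continuous_det.comp (continuous_const.add continuous_id)
    have h0 : (0 : ℝ) < ((1 : E →L[ℝ] E) + 0).det := by
      rw [add_zero]
      have : (1 : E →L[ℝ] E).det = 1 := LinearMap.det_id
      rw [this]; exact one_pos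
    obtain ⟨ε, hε, h⟩ := Metric.eventually_nhds_iff.1 (hc.continuousAt.eventually (lt_mem_nhds h0))
    exact ⟨ε, hε, fun A hA => h (by simpa using hA)⟩
  set ε : ℝ := min ε₀ 1 / (K + 1) with hεdef
  have hK1 : (0 : ℝ) < K + 1 := by positivity
  have hε : 0 < ε := by positivity
  have hsmall : ∀ t : ℝ, 0 < t → t < ε → t * K < min ε₀ 1 := by
    intro t ht hte
    have : t * (K + 1) < min ε₀ 1 := (lt_div_iff₀ hK1).1 hte
    nlinarith
  have hmeas : ∀ t : ℝ, Measurable fun x => (1 + t • fderiv ℝ φ x).det := fun t =>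
    ContinuousLinearMap.continuous_det.measurable.comp
      (((measurable_fderiv ℝ φ).const_smul t).const_add 1)
  have hμfin : μ (ball 0 1) ≠ ⊤ := measure_ball_lt_top.ne
  have key : ∀ t : ℝ, 0 < t → t < ε →
      IntegrableOn (fun x => (1 + t • fderiv ℝ φ x).det) (ball 0 1) μ ∧
      ∫ x in ball (0 : E) 1, (1 + t • fderiv ℝ φ x).det ∂μ = μ.real (ball 0 1) := by
    intro t ht hte
    have htK := hsmall t ht hte
    have hlt1 : t * K < 1 := htK.trans_le (min_le_right _ _)
    have hpos : ∀ x, 0 < (1 + t • fderiv ℝ φ x).det := by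
      intro x
      apply hdet
      rw [norm_smul, Real.norm_of_nonneg ht.le]
      have := norm_fderiv_le_of_lipschitz ℝ (x₀ := x) hφ
      calc t * ‖fderiv ℝ φ x‖ ≤ t * K := by gcongr
        _ < ε₀ := htK.trans_le (min_le_left _ _)
    have hinj : Function.Injective fun x => x + t • φ x := by
      intro x y hxy
      by_contra hne
      have h1 : x - y = t • (φ y - φ x) := by
        simp only at hxy
        rw [smul_sub, sub_eq_sub_iff_add_eq_add, hxy, add_comm]
      have h2 : ‖x - y‖ ≤ t * K * ‖x - y‖ := by
        conv_lhs => rw [h1]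
        rw [norm_smul, Real.norm_of_nonneg ht.le, mul_assoc]
        gcongr
        rw [norm_sub_rev (x) y]
        exact hφ.norm_sub_le y x
      have h3 : 0 < ‖x - y‖ := norm_pos_iff.2 (sub_ne_zero.2 hne)
      nlinarith
    have himg : (fun x => x + t • φ x) '' ball 0 1 = ball 0 1 := by
      have hmaps : ∀ x, ‖x‖ < 1 ↔ ‖x + t • φ x‖ < 1 := by
        have hge : ∀ x, 1 ≤ ‖x‖ → x + t • φ x = x := fun x hx => by simp [hφ0 x hx]
        intro x
        constructor
        · intro hx
          by_contra hcon
          push Not at hcon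
          have := hge _ hcon
          have h4 := hinj (a₁ := x + t • φ x) (a₂ := x) this
          rw [h4] at hcon
          linarith
        · intro hx
          by_contra hcon
          push Not at hcon
          rw [hge x hcon] at hx
          linarith
      have hsurj : Function.Surjective fun x => x + t • φ x := by
        intro y
        have hcontr : ContractingWith (Real.toNNReal t * K) fun x => y - t • φ x := by
          refine ⟨by rw [← NNReal.coe_lt_coe]; simpa [ht.le] using hlt1, LipschitzWith.of_dist_le_mul fun a b => ?_⟩
          rw [dist_sub_left, dist_smul₀, Real.norm_of_nonneg ht.le, NNReal.coe_mul, Real.coe_toNNReal _ ht.le,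
            mul_assoc]
          gcongr
          exact hφ.dist_le_mul a b
        refine ⟨ContractingWith.fixedPoint _ hcontr, ?_⟩
        have := hcontr.fixedPoint_isFixedPt
        have h5 : y - t • φ (ContractingWith.fixedPoint _ hcontr) =
          ContractingWith.fixedPoint _ hcontr := this
        simp only
        nth_rewrite 1 [← h5]
        abel
      ext y
      constructor
      · rintro ⟨x, hx, rfl⟩
        simpa using (hmaps x).1 (by simpa using hx)
      · intro hy
        obtain ⟨x, rfl⟩ := hsurj y
        exact ⟨x, by simpa using (hmaps x).2 (by simpa using hy), rfl⟩
    have hder : ∀ x ∈ ball (0 : E) 1, HasFDerivWithinAt (fun x => x + t • φ x)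
        (1 + t • fderiv ℝ φ x) (ball 0 1) x := fun x hx =>
      ((hasFDerivAt_id x).add ((hd x hx).hasFDerivAt.const_smul t)).hasFDerivWithinAt
    have hlin := lintegral_abs_det_fderiv_eq_addHaar_image μ measurableSet_ball hder hinj.injOn
    rw [himg] at hlin
    simp only [abs_of_pos (hpos _)] at hlin
    constructor
    · refine ⟨(hmeas t).aestronglyMeasurable, ?_⟩
      rw [hasFiniteIntegral_iff_ofReal (Eventually.of_forall fun x => (hpos x).le), hlin]
      exact hμfin.lt_top
    · rw [integral_eq_lintegral_of_nonneg_ae (Eventually.of_forall fun x => (hpos x).le)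
        (hmeas t).aestronglyMeasurable, hlin]
      rfl
  obtain ⟨w, t, ht, hw⟩ := exists_extrapolation_weights (Module.finrank ℝ E) hε
  have hsum : ∑ i, w i = 1 := by
    have := hw 1 (by simp)
    simpa using this.symm
  have hpt : ∀ x, (1 + fderiv ℝ φ x).det = ∑ i, w i * (1 + t i • fderiv ℝ φ x).det := by
    intro x
    obtain ⟨P, hP, hPe⟩ := exists_polynomial_eval_eq_det_one_add_smul (fderiv ℝ φ x)
    have := hw P hP
    simp only [hPe] at this
    simpa using this
  simp only [hpt]
  rw [integral_finsetSum]
  · simp only [integral_const_mul, (key _ (ht _).1 (ht _).2).2, ← Finset.sum_mul, hsum, one_mul]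
  · exact fun i _ => (key _ (ht i).1 (ht i).2).1.const_mul _

/-- A `C¹` self-map which is the identity outside the unit ball has a zero. -/
theorem exists_eq_zero_of_contDiff_of_eq_id {E : Type*} [NormedAddCommGroup E]
    [InnerProductSpace ℝ E] [FiniteDimensional ℝ E] {F : E → E} (hF : ContDiff ℝ 1 F)
    (hid : ∀ x, 1 ≤ ‖x‖ → F x = x) : ∃ x, F x = 0 := by
  by_contra! hne
  borelize E
  let μ : Measure E := Measure.addHaar
  let r : E → E := fun x => ‖F x‖⁻¹ • F x
  have hr : ContDiff ℝ 1 r :=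
    ((hF.norm ℝ hne).inv fun x => norm_ne_zero_iff.2 (hne x)).smul hF
  have hr1 : ∀ x, ‖r x‖ = 1 := fun x => by
    simp [r, norm_smul, inv_mul_cancel₀ (norm_ne_zero_iff.2 (hne x))]
  have hrS : ∀ x, ‖x‖ = 1 → r x = x := fun x hx => by simp [r, hid x hx.ge, hx]
  let φ : E → E := fun x => if ‖x‖ < 1 then r x - x else 0
  have hφin : ∀ x, ‖x‖ ≤ 1 → φ x = r x - x := by
    intro x hx
    by_cases h : ‖x‖ < 1
    · simp [φ, h]
    · simp [φ, h, hrS x (le_antisymm hx (not_lt.1 h))]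
  have hφout : ∀ x, 1 ≤ ‖x‖ → φ x = 0 := fun x hx => by simp [φ, not_lt.2 hx]
  obtain ⟨K, hK⟩ := (hr.sub contDiff_id).contDiffOn.exists_lipschitzOnWith one_ne_zero
    (convex_closedBall (0 : E) 1) (isCompact_closedBall 0 1)
  have hmixed : ∀ x y, ‖x‖ ≤ 1 → 1 ≤ ‖y‖ → dist (φ x) (φ y) ≤ K * dist x y := by
    intro x y hx hy
    obtain ⟨z, hz, hz1⟩ : ∃ z ∈ segment ℝ x y, ‖z‖ = 1 := by
      have := (convex_segment x y).isPreconnected.intermediate_value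
        (left_mem_segment ℝ x y) (right_mem_segment ℝ x y) continuous_norm.continuousOn
      obtain ⟨z, hz, hz1⟩ := this ⟨hx, hy⟩
      exact ⟨z, hz, hz1⟩
    have h1 : φ y = φ z := by rw [hφout y hy, hφout z hz1.ge]
    rw [h1, hφin x hx, hφin z hz1.le]
    refine (hK.dist_le_mul x (by simpa using hx) z (by simp [hz1])).trans ?_
    gcongr
    have := dist_add_dist_of_mem_segment hz
    have := dist_nonneg (x := z) (y := y)
    linarith
  have hφ : LipschitzWith K φ := by
    refine LipschitzWith.of_dist_le_mul fun x y => ?_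
    rcases le_total ‖x‖ 1 with hx | hx <;> rcases le_total ‖y‖ 1 with hy | hy
    · rw [hφin x hx, hφin y hy]
      exact hK.dist_le_mul x (by simpa using hx) y (by simpa using hy)
    · exact hmixed x y hx hy
    · rw [dist_comm, dist_comm x]
      exact hmixed y x hy hx
    · rw [hφout x hx, hφout y hy, dist_self]
      positivity
  have hφd : ∀ x ∈ ball (0 : E) 1, HasFDerivAt φ (fderiv ℝ r x - 1) x := by
    intro x hx
    have h1 : HasFDerivAt (fun x => r x - x) (fderiv ℝ r x - 1) x :=
      ((hr.differentiable one_ne_zero) x).hasFDerivAt.sub (hasFDerivAt_id x)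
    refine h1.congr_of_eventuallyEq ?_
    filter_upwards [isOpen_ball.mem_nhds hx] with y hy
    exact hφin y (mem_ball_zero_iff.1 hy).le
  have hJac := integral_det_one_add_fderiv_eq μ hφ hφout fun x hx => (hφd x hx).differentiableAt
  have hzero : ∀ x ∈ ball (0 : E) 1, (1 + fderiv ℝ φ x).det = 0 := by
    intro x hx
    rw [(hφd x hx).fderiv, add_sub_cancel]
    by_contra hdet
    have hsurj : Function.Surjective (fderiv ℝ r x) := by
      have := LinearMap.range_eq_top.1 ((LinearMap.isUnit_iff_range_eq_top _).1
        ((LinearMap.isUnit_iff_isUnit_det _).2 (isUnit_iff_ne_zero.2 hdet)))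
      exact this
    obtain ⟨w, hw⟩ := hsurj (r x)
    have h2 : HasFDerivAt r (fderiv ℝ r x) x := ((hr.differentiable one_ne_zero) x).hasFDerivAt
    have h3 := (h2.inner ℝ h2)
    have h4 : (fun y => inner ℝ (r y) (r y)) = fun _ => (1 : ℝ) := by
      ext y
      rw [real_inner_self_eq_norm_sq, hr1, one_pow]
    rw [h4] at h3
    have h5 := congrArg (fun L => L w) (h3.unique (hasFDerivAt_const (1 : ℝ) x))
    simp [hw, hr1] at h5
  rw [setIntegral_congr_fun measurableSet_ball hzero] at hJac
  simp only [integral_zero] at hJac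
  have : 0 < μ.real (ball (0 : E) 1) :=
    ENNReal.toReal_pos (measure_ball_pos μ _ one_pos).ne' measure_ball_lt_top.ne
  linarith

/-- Uniform `C¹` approximation on a closed subset of a finite-dimensional space. -/
theorem exists_contDiff_dist_lt_of_continuousOn {E F : Type*} [NormedAddCommGroup E]
    [NormedSpace ℝ E] [FiniteDimensional ℝ E] [NormedAddCommGroup F] [NormedSpace ℝ F]
    [FiniteDimensional ℝ F] {K : Set F} (hK : IsClosed K) {h : F → E} (hh : ContinuousOn h K)
    {ε : ℝ} (hε : 0 < ε) : ∃ g : F → E, ContDiff ℝ 1 g ∧ ∀ x ∈ K, dist (g x) (h x) < ε := by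
  let e : E ≃L[ℝ] (Fin (Module.finrank ℝ E) → ℝ) :=
    (Module.finBasis ℝ E).equivFun.toContinuousLinearEquiv
  let f : C(K, Fin (Module.finrank ℝ E) → ℝ) :=
    ⟨fun x => e (h x), e.continuous.comp hh.domRestrict⟩
  obtain ⟨k, hk⟩ := f.exists_restrict_eq hK
  obtain ⟨g, hg, hgk, -⟩ := (e.symm.continuous.comp k.continuous).exists_contDiff_approx 1
    (continuous_const (y := ε)) fun _ => hε
  refine ⟨g, hg, fun x hx => ?_⟩
  have h1 : k x = e (h x) := congrArg (fun q => q ⟨x, hx⟩) hk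
  have := hgk x
  simpa [h1] using this

/-- A continuous map on a closed ball which moves points by at most half the radius
has a zero. -/
theorem exists_eq_zero_of_norm_sub_le {E : Type*} [NormedAddCommGroup E]
    [InnerProductSpace ℝ E] [FiniteDimensional ℝ E] {δ : ℝ} (hδ : 0 < δ) {G : E → E}
    (hG : ContinuousOn G (closedBall 0 δ)) (h : ∀ x ∈ closedBall (0 : E) δ, ‖G x - x‖ ≤ δ / 2) :
    ∃ x ∈ closedBall (0 : E) δ, G x = 0 := by
  by_contra! hne
  let G₁ : E → E := fun x => δ⁻¹ • G (δ • x)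
  have hmem : ∀ x ∈ closedBall (0 : E) 1, δ • x ∈ closedBall (0 : E) δ := by
    intro x hx
    rw [mem_closedBall_zero_iff] at hx ⊢
    rw [norm_smul, Real.norm_of_nonneg hδ.le]
    nlinarith
  have hG₁ : ContinuousOn G₁ (closedBall 0 1) :=
    (hG.comp (continuous_const_smul δ).continuousOn hmem).const_smul _
  have hG₁ne : ∀ x ∈ closedBall (0 : E) 1, G₁ x ≠ 0 := fun x hx =>
    smul_ne_zero (inv_ne_zero hδ.ne') (hne _ (hmem x hx))
  have hG₁le : ∀ x ∈ closedBall (0 : E) 1, ‖G₁ x - x‖ ≤ 1 / 2 := by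
    intro x hx
    have h1 : G₁ x - x = δ⁻¹ • (G (δ • x) - δ • x) := by
      rw [smul_sub, smul_smul, inv_mul_cancel₀ hδ.ne', one_smul]
    rw [h1, norm_smul, Real.norm_of_nonneg (inv_pos.2 hδ).le]
    have := h _ (hmem x hx)
    calc δ⁻¹ * ‖G (δ • x) - δ • x‖ ≤ δ⁻¹ * (δ / 2) := by gcongr
      _ = 1 / 2 := by field_simp
  obtain ⟨x₀, hx₀, hmin⟩ := (isCompact_closedBall (0 : E) 1).exists_isMinOn
    ⟨0, by simp⟩ hG₁.norm
  have hη : 0 < ‖G₁ x₀‖ := norm_pos_iff.2 (hG₁ne x₀ hx₀)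
  obtain ⟨g, hg, hgG⟩ := exists_contDiff_dist_lt_of_continuousOn isClosed_closedBall hG₁
    (lt_min hη (by norm_num : (0 : ℝ) < 1 / 8))
  let χ : ContDiffBump (0 : E) := ⟨3 / 4, 1, by norm_num, by norm_num⟩
  obtain ⟨x, hx⟩ := exists_eq_zero_of_contDiff_of_eq_id
    (F := fun x => x + χ x • (g x - x))
    (contDiff_id.add (χ.contDiff.smul (hg.sub contDiff_id))) fun x hx => by
      have : χ x = 0 := χ.zero_of_le_dist (by simpa using hx)
      simp [this]
  rcases le_or_gt 1 ‖x‖ with hx1 | hx1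
  · have : χ x = 0 := χ.zero_of_le_dist (by simpa using hx1)
    simp only [this, zero_smul, add_zero] at hx
    rw [hx, norm_zero] at hx1
    linarith
  have hxB : x ∈ closedBall (0 : E) 1 := by simpa using hx1.le
  have hd := hgG x hxB
  rcases le_or_gt ‖x‖ (3 / 4) with hx2 | hx2
  · have : χ x = 1 := χ.one_of_mem_closedBall (by simpa using hx2)
    simp only [this, one_smul, add_sub_cancel] at hx
    rw [hx, dist_zero_left] at hd
    have h1 : ‖G₁ x₀‖ ≤ ‖G₁ x‖ := hmin hxB
    have := min_le_left ‖G₁ x₀‖ (1 / 8 : ℝ)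
    linarith
  · have h1 : ‖g x - x‖ ≤ 5 / 8 := by
      have h2 := hG₁le x hxB
      have h3 : ‖g x - G₁ x‖ < 1 / 8 := by
        rw [← dist_eq_norm]; exact hd.trans_le (min_le_right _ _)
      have := norm_add_le (g x - G₁ x) (G₁ x - x)
      rw [sub_add_sub_cancel] at this
      linarith
    have h2 : x = -(χ x • (g x - x)) := eq_neg_of_add_eq_zero_left hx
    have h3 : ‖x‖ ≤ 5 / 8 := by
      conv_lhs => rw [h2]
      rw [norm_neg, norm_smul, Real.norm_of_nonneg χ.nonneg]
      have := χ.le_one (x := x)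
      have := χ.nonneg (x := x)
      nlinarith [norm_nonneg (g x - x)]
    linarith

/-- A map of a ball of `E` that is close to the identity and factors through `F` forces
`dim E ≤ dim F`. -/
theorem finrank_le_of_norm_comp_sub_le {E F : Type*} [NormedAddCommGroup E]
    [InnerProductSpace ℝ E] [FiniteDimensional ℝ E] [NormedAddCommGroup F] [NormedSpace ℝ F]
    [FiniteDimensional ℝ F] {δ : ℝ} (hδ : 0 < δ) {u : E → F} {h : F → E}
    (hu : ContinuousOn u (closedBall 0 δ)) (hh : ContinuousOn h (u '' closedBall 0 δ))
    (hclose : ∀ x ∈ closedBall (0 : E) δ, ‖h (u x) - x‖ ≤ δ / 4) :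
    Module.finrank ℝ E ≤ Module.finrank ℝ F := by
  by_contra! hlt
  obtain ⟨g, hg, hgh⟩ := exists_contDiff_dist_lt_of_continuousOn
    ((isCompact_closedBall (0 : E) δ).image_of_continuousOn hu).isClosed hh
    (by positivity : 0 < δ / 8)
  obtain ⟨c, hc, hcδ⟩ := (hg.dense_compl_range_of_finrank_lt_finrank hlt).exists_dist_lt 0
    (by positivity : 0 < δ / 8)
  rw [dist_zero_left] at hcδ
  obtain ⟨x, hx, hx0⟩ := exists_eq_zero_of_norm_sub_le hδ (G := fun x => g (u x) - c)
    ((hg.continuous.comp_continuousOn hu).sub continuousOn_const) fun x hx => by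
      have h1 := hgh _ (mem_image_of_mem u hx)
      rw [dist_eq_norm] at h1
      have h2 := hclose x hx
      have h3 : g (u x) - c - x = (g (u x) - h (u x)) + (h (u x) - x) - c := by abel
      rw [h3]
      have := norm_sub_le ((g (u x) - h (u x)) + (h (u x) - x)) c
      have := norm_add_le (g (u x) - h (u x)) (h (u x) - x)
      linarith
  exact hc ⟨u x, sub_eq_zero.1 hx0⟩

/-- `π` selects a nearest point of `M`. -/
structure IsNearestPointMap {E : Type*} [MetricSpace E] (M : Set E) (π : E → E) : Prop where
  mem : ∀ x, π x ∈ M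
  dist_eq : ∀ x, dist x (π x) = infDist x M

theorem IsCompact.exists_isNearestPointMap {E : Type*} [MetricSpace E] {M : Set E}
    (hM : IsCompact M) (hne : M.Nonempty) : ∃ π : E → E, IsNearestPointMap M π := by
  choose π h1 h2 using fun x => hM.exists_infDist_eq_dist hne x
  exact ⟨π, h1, fun x => (h2 x).symm⟩

theorem IsNearestPointMap.eq_of_dist_eq {E : Type*} [MetricSpace E] {M : Set E} {π : E → E}
    (hπ : IsNearestPointMap M π) {τ : ℝ} (hr : HasReachGE M τ) {x y : E}
    (hx : infDist x M < τ) (hy : y ∈ M) (hxy : dist x y = infDist x M) : π x = y :=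
  (hr x hx).unique ⟨hπ.mem x, hπ.dist_eq x⟩ ⟨hy, hxy⟩

theorem IsNearestPointMap.continuousAt {E : Type*} [MetricSpace E] {M : Set E} {π : E → E}
    (hπ : IsNearestPointMap M π) (hM : IsCompact M) {τ : ℝ} (hr : HasReachGE M τ) {x : E}
    (hx : infDist x M < τ) : ContinuousAt π x := by
  refine hM.tendsto_nhds_of_unique_mapClusterPt (Eventually.of_forall hπ.mem) fun y hy hcl => ?_
  refine (hπ.eq_of_dist_eq hr hx hy (le_antisymm ?_ (infDist_le_dist_of_mem hy))).symm
  refine le_of_forall_pos_le_add fun ε hε => ?_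
  have h1 : ∃ᶠ z in 𝓝 x, π z ∈ ball y (ε / 3) :=
    hcl.frequently (ball_mem_nhds y (by positivity))
  obtain ⟨z, hz1, hz2⟩ := (h1.and_eventually (ball_mem_nhds x (by positivity : 0 < ε / 3))).exists
  rw [mem_ball] at hz1
  have h2 := dist_triangle4 x z (π z) y
  have h3 := infDist_le_infDist_add_dist (s := M) (x := z) (y := x)
  rw [hπ.dist_eq z, dist_comm x z] at h2
  linarith

section Ray

variable {E : Type*} [NormedAddCommGroup E] [InnerProductSpace ℝ E]

theorem infDist_add_smul_eq_of_le {M : Set E} {p v : E} (hp : p ∈ M) (hv : ‖v‖ = 1) {r t : ℝ}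
    (hr : 0 ≤ r) (hrt : r ≤ t) (ht : infDist (p + t • v) M = t) : infDist (p + r • v) M = r := by
  apply le_antisymm
  · refine (infDist_le_dist_of_mem hp).trans ?_
    rw [dist_eq_norm, add_sub_cancel_left, norm_smul, hv, mul_one, Real.norm_eq_abs,
      abs_of_nonneg hr]
  · have h := infDist_le_infDist_add_dist (s := M) (x := p + t • v) (y := p + r • v)
    have h1 : dist (p + t • v) (p + r • v) = t - r := by
      rw [dist_eq_norm, add_sub_add_left_eq_sub, ← sub_smul, norm_smul, hv, mul_one,
        Real.norm_eq_abs, abs_of_nonneg (by linarith)]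
    linarith

variable [FiniteDimensional ℝ E]

theorem IsNearestPointMap.infDist_add_smul_eq_add {M : Set E} {π : E → E}
    (hπ : IsNearestPointMap M π) (hM : IsCompact M) {τ : ℝ} (hr : HasReachGE M τ) {p v : E}
    (hp : p ∈ M) (hv : ‖v‖ = 1) {t s : ℝ} (hs : 0 < s) (hst : 2 * s < t) (htτ : t + 2 * s < τ)
    (ht : infDist (p + t • v) M = t) : infDist (p + (t + s) • v) M = t + s := by
  set x := p + t • v with hx
  have hdist : ∀ w ∈ closedBall (0 : E) (2 * s),
      0 < infDist (x + w) M ∧ infDist (x + w) M < τ := by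
    intro w hw
    rw [mem_closedBall_zero_iff] at hw
    have h1 := infDist_le_infDist_add_dist (s := M) (x := x) (y := x + w)
    have h2 := infDist_le_infDist_add_dist (s := M) (x := x + w) (y := x)
    rw [dist_self_add_left] at h2
    rw [dist_self_add_right] at h1
    constructor <;> linarith
  have hnorm : ∀ y, ‖y - π y‖ = infDist y M := fun y => by rw [← dist_eq_norm, hπ.dist_eq]
  obtain ⟨w, hw, hw0⟩ := exists_eq_zero_of_norm_sub_le (E := E) (by positivity : 0 < 2 * s)
    (G := fun w => w - (s / ‖x + w - π (x + w)‖) • (x + w - π (x + w))) (by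
      intro w hw
      apply ContinuousAt.continuousWithinAt
      have h1 : ContinuousAt (fun w => π (x + w)) w :=
        ContinuousAt.comp (f := fun w => x + w) (g := π)
          (hπ.continuousAt hM hr (hdist w hw).2) (by fun_prop)
      have h2 : ‖x + w - π (x + w)‖ ≠ 0 := by rw [hnorm]; exact (hdist w hw).1.ne'
      have h3 : ContinuousAt (fun w => x + w - π (x + w)) w :=
        (by fun_prop : ContinuousAt (fun w => x + w) w).sub h1
      exact continuousAt_id.sub ((continuousAt_const.div h3.norm h2).smul h3)) (by
      intro w hw
      have h2 : ‖x + w - π (x + w)‖ ≠ 0 := by rw [hnorm]; exact (hdist w hw).1.ne'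
      rw [sub_sub_cancel_left, norm_neg, norm_smul, norm_div, norm_norm,
        div_mul_cancel₀ _ h2, Real.norm_eq_abs, abs_of_pos hs]
      linarith)
  obtain ⟨hρ0, hρτ⟩ := hdist w hw
  set q := π (x + w) with hq
  have hρ := hnorm (x + w)
  rw [← hq] at hρ
  set ρ := infDist (x + w) M
  simp only [hρ] at hw0
  have hww : w = (s / ρ) • (x + w - q) := sub_eq_zero.1 hw0
  have hwn : ‖w‖ = s := by
    rw [hww, norm_smul, hρ, norm_div, Real.norm_eq_abs, Real.norm_eq_abs, abs_of_pos hs,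
      abs_of_pos hρ0, div_mul_cancel₀ _ hρ0.ne']
  have h1 : t ≤ ρ + s := by
    have := infDist_le_infDist_add_dist (s := M) (x := x) (y := x + w)
    rw [dist_self_add_right, hwn, ht] at this
    exact this
  have h2 : ρ ≤ t + s := by
    have := infDist_le_infDist_add_dist (s := M) (x := x + w) (y := x)
    rw [dist_self_add_left, hwn, ht] at this
    exact this
  have hxq : x - q = ((ρ - s) / ρ) • (x + w - q) := by
    have : x - q = (x + w - q) - w := by abel
    rw [this]
    nth_rewrite 2 [hww]
    rw [← one_smul ℝ (x + w - q), smul_smul, ← sub_smul, mul_one, one_smul, sub_div,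
      div_self hρ0.ne']
  have hxqn : ‖x - q‖ = ρ - s := by
    rw [hxq, norm_smul, hρ, norm_div, Real.norm_eq_abs, Real.norm_eq_abs,
      abs_of_pos (by linarith : 0 < ρ - s), abs_of_pos hρ0, div_mul_cancel₀ _ hρ0.ne']
  have hqM : q ∈ M := hπ.mem _
  have h3 : t ≤ ρ - s := by
    rw [← ht, ← hxqn, ← dist_eq_norm]; exact infDist_le_dist_of_mem hqM
  have hρt : ρ = t + s := by linarith
  have hpq : p = q := by
    have hxτ : infDist x M < τ := by rw [ht]; linarith
    rw [← hπ.eq_of_dist_eq hr hxτ hqM (by rw [ht, dist_eq_norm, hxqn]; linarith)]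
    refine (hπ.eq_of_dist_eq hr hxτ hp ?_).symm
    rw [ht, dist_eq_norm, hx, add_sub_cancel_left, norm_smul, hv, mul_one, Real.norm_eq_abs,
      abs_of_pos (by linarith)]
  have hy : x + w = p + (t + s) • v := by
    have h4 : x - p = t • v := by rw [hx, add_sub_cancel_left]
    rw [hpq] at h4
    rw [h4, show ρ - s = t by linarith] at hxq
    have h5 : x + w - q = ρ • v := by
      have ht0 : t ≠ 0 := by linarith
      calc x + w - q = (ρ / t) • ((t / ρ) • (x + w - q)) := by
            rw [smul_smul, div_mul_div_cancel₀ ht0, div_self hρ0.ne', one_smul]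
        _ = ρ • v := by rw [← hxq, smul_smul, div_mul_cancel₀ _ ht0]
    rw [hpq, ← hρt, ← h5]
    abel
  rw [← hy, ← hρt]

/-- Along a normal ray the foot point stays a nearest point up to the reach. -/
theorem IsNearestPointMap.infDist_add_smul_eq {M : Set E} {π : E → E}
    (hπ : IsNearestPointMap M π) (hM : IsCompact M) {τ : ℝ} (hr : HasReachGE M τ) {p v : E}
    (hp : p ∈ M) (hv : ‖v‖ = 1) {t r : ℝ} (ht0 : 0 < t) (ht : infDist (p + t • v) M = t)
    (hr0 : 0 ≤ r) (hrτ : r < τ) : infDist (p + r • v) M = r := by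
  rcases le_total r t with hrt | hrt
  · exact infDist_add_smul_eq_of_le hp hv hr0 hrt ht
  have hsub : Icc t r ⊆ {t' | infDist (p + t' • v) M = t'} := by
    refine IsClosed.Icc_subset_of_forall_exists_gt ?_ ht ?_
    · refine IsClosed.inter (isClosed_eq ?_ continuous_id) isClosed_Icc
      exact (continuous_infDist_pt M).comp (by fun_prop)
    · rintro t' ⟨ht', htt', ht'r⟩ y hy
      rw [mem_Ioi] at hy
      let s := min (y - t') (min (t' / 4) ((τ - t') / 4))
      have hs : 0 < s := by
        refine lt_min (by linarith) (lt_min (by linarith) (by linarith))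
      have hs1 : s ≤ y - t' := min_le_left _ _
      have hs2 : s ≤ t' / 4 := (min_le_right _ _).trans (min_le_left _ _)
      have hs3 : s ≤ (τ - t') / 4 := (min_le_right _ _).trans (min_le_right _ _)
      exact ⟨t' + s, hπ.infDist_add_smul_eq_add hM hr hp hv hs (by linarith) (by linarith) ht',
        by linarith, by linarith⟩
  exact hsub ⟨hrt, le_rfl⟩

theorem IsNearestPointMap.infDist_add_smul_sub {M : Set E} {π : E → E}
    (hπ : IsNearestPointMap M π) (hM : IsCompact M) {τ : ℝ} (hr : HasReachGE M τ) {x : E} {c : ℝ}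
    (hc : 0 ≤ c) (hcτ : c * infDist x M < τ) :
    infDist (π x + c • (x - π x)) M = c * infDist x M := by
  have hn : ‖x - π x‖ = infDist x M := by rw [← dist_eq_norm, hπ.dist_eq]
  rcases infDist_nonneg (x := x) (s := M) |>.eq_or_lt with h0 | h0
  · rw [← h0, norm_eq_zero] at hn
    rw [hn, smul_zero, add_zero, ← h0, mul_zero, infDist_zero_of_mem (hπ.mem x)]
  · set t := infDist x M
    have hv : ‖t⁻¹ • (x - π x)‖ = 1 := by
      rw [norm_smul, hn, norm_inv, Real.norm_eq_abs, abs_of_pos h0, inv_mul_cancel₀ h0.ne']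
    have h1 := hπ.infDist_add_smul_eq hM hr (hπ.mem x) hv h0 (by
      rw [smul_smul, mul_inv_cancel₀ h0.ne', one_smul, add_sub_cancel]) (by positivity) hcτ
    rwa [smul_smul, mul_assoc, mul_inv_cancel₀ h0.ne', mul_one] at h1

theorem IsNearestPointMap.apply_add_smul_sub {M : Set E} {π : E → E}
    (hπ : IsNearestPointMap M π) (hM : IsCompact M) {τ : ℝ} (hr : HasReachGE M τ) {x : E} {c : ℝ}
    (hc : 0 ≤ c) (hcτ : c * infDist x M < τ) : π (π x + c • (x - π x)) = π x := by
  have h := hπ.infDist_add_smul_sub hM hr hc hcτ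
  refine hπ.eq_of_dist_eq hr (by rwa [h]) (hπ.mem x) ?_
  rw [h, dist_eq_norm, add_sub_cancel_left, norm_smul, Real.norm_eq_abs, abs_of_nonneg hc,
    ← dist_eq_norm, hπ.dist_eq]

/-- Federer's inequality for sets of positive reach. -/
theorem IsNearestPointMap.inner_le {M : Set E} {π : E → E}
    (hπ : IsNearestPointMap M π) (hM : IsCompact M) {τ : ℝ} (hτ : 0 < τ) (hr : HasReachGE M τ)
    (x : E) {q : E} (hq : q ∈ M) :
    2 * τ * inner ℝ (q - π x) (x - π x) ≤ infDist x M * ‖q - π x‖ ^ 2 := by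
  have hn : ‖x - π x‖ = infDist x M := by rw [← dist_eq_norm, hπ.dist_eq]
  rcases infDist_nonneg (x := x) (s := M) |>.eq_or_lt with h0 | h0
  · rw [← h0, norm_eq_zero] at hn
    simp [hn, ← h0]
  set t := infDist x M with ht
  have key : ∀ r ∈ Ico 0 τ, 2 * r * inner ℝ (q - π x) (x - π x) ≤ t * ‖q - π x‖ ^ 2 := by
    intro r ⟨hr0, hrτ⟩
    have h1 := hπ.infDist_add_smul_sub hM hr (x := x) (c := r / t) (by positivity) (by
      rwa [div_mul_cancel₀ _ h0.ne'])
    rw [div_mul_cancel₀ _ h0.ne'] at h1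
    have h2 := infDist_le_dist_of_mem (x := π x + (r / t) • (x - π x)) hq
    rw [h1, dist_comm, dist_eq_norm, ← sub_sub] at h2
    have h3 := norm_sub_sq_real (q - π x) ((r / t) • (x - π x))
    rw [inner_smul_right, norm_smul, hn, Real.norm_eq_abs, abs_of_nonneg (by positivity),
      div_mul_cancel₀ _ h0.ne'] at h3
    have h4 : r ^ 2 ≤ ‖q - π x - (r / t) • (x - π x)‖ ^ 2 := by gcongr
    have h5 : 2 * (r / t * inner ℝ (q - π x) (x - π x)) ≤ ‖q - π x‖ ^ 2 := by linarith
    have h6 : 2 * r * inner ℝ (q - π x) (x - π x)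
        = t * (2 * (r / t * inner ℝ (q - π x) (x - π x))) := by field_simp
    rw [h6]
    gcongr
  have hmem : τ ∈ closure (Ico 0 τ) := by
    rw [closure_Ico hτ.ne]; exact ⟨hτ.le, le_rfl⟩
  have hcl : IsClosed {r : ℝ | 2 * r * inner ℝ (q - π x) (x - π x) ≤ t * ‖q - π x‖ ^ 2} :=
    isClosed_le (by fun_prop) (by fun_prop)
  exact closure_minimal key hcl hmem

theorem IsNearestPointMap.mul_norm_sq_le_inner {M : Set E} {π : E → E}
    (hπ : IsNearestPointMap M π) (hM : IsCompact M) {τ : ℝ} (hτ : 0 < τ) (hr : HasReachGE M τ)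
    {ε : ℝ} {x y : E} (hx : infDist x M ≤ ε) (hy : infDist y M ≤ ε) :
    (τ - ε) * ‖π x - π y‖ ^ 2 ≤ τ * inner ℝ (π x - π y) (x - y) := by
  have h1 := hπ.inner_le hM hτ hr x (hπ.mem y)
  have h2 := hπ.inner_le hM hτ hr y (hπ.mem x)
  rw [norm_sub_rev] at h1
  have h3 : infDist x M * ‖π x - π y‖ ^ 2 ≤ ε * ‖π x - π y‖ ^ 2 := by gcongr
  have h4 : infDist y M * ‖π x - π y‖ ^ 2 ≤ ε * ‖π x - π y‖ ^ 2 := by gcongr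
  have h5 : inner ℝ (π y - π x) (x - π x) + inner ℝ (π x - π y) (y - π y)
      = ‖π x - π y‖ ^ 2 - inner ℝ (π x - π y) (x - y) := by
    rw [← neg_sub (π x) (π y), inner_neg_left, ← real_inner_self_eq_norm_sq, ← inner_sub_right,
      neg_add_eq_sub, ← inner_sub_right]
    congr 1; abel
  nlinarith

end Ray

theorem Topology.IsEmbedding.continuousOn_extend {X Y Z : Type*} [TopologicalSpace X]
    [TopologicalSpace Y] [TopologicalSpace Z] {j : X → Y} (hj : IsEmbedding j) {g : X → Z}
    (hg : Continuous g) (z : Y → Z) : ContinuousOn (Function.extend j g z) (range j) := by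
  rintro _ ⟨x, rfl⟩
  rw [ContinuousWithinAt, ← hj.isInducing.map_nhds_eq, tendsto_map'_iff,
    Function.Injective.extend_apply hj.injective, Function.extend_comp hj.injective]
  exact hg.continuousAt

/-- A linear map expanding norms by the factor `c` has determinant at least `c ^ dim`. -/
theorem LinearMap.pow_finrank_le_abs_det {W : Type*} [NormedAddCommGroup W] [NormedSpace ℝ W]
    [FiniteDimensional ℝ W] (L : W →ₗ[ℝ] W) {c : ℝ} (hc : 0 < c) (hL : ∀ w, c * ‖w‖ ≤ ‖L w‖) :
    c ^ Module.finrank ℝ W ≤ |LinearMap.det L| := by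
  borelize W
  let μ : Measure W := Measure.addHaar
  have hinj : Function.Injective L := by
    rw [injective_iff_map_eq_zero]
    intro w hw
    have := hL w
    rw [hw, norm_zero] at this
    exact norm_le_zero_iff.1 (by nlinarith [norm_nonneg w])
  have hsurj : Function.Surjective L := LinearMap.injective_iff_surjective.1 hinj
  have hsub : ball (0 : W) c ⊆ L '' ball 0 1 := by
    intro y hy
    obtain ⟨w, rfl⟩ := hsurj y
    refine ⟨w, ?_, rfl⟩
    rw [mem_ball_zero_iff] at hy ⊢
    have := hL w
    nlinarith
  have h1 := measure_mono (μ := μ) hsub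
  rw [Measure.addHaar_image_linearMap, Measure.addHaar_ball_of_pos μ 0 hc,
    ENNReal.mul_le_mul_iff_left (measure_ball_pos μ _ one_pos).ne' measure_ball_lt_top.ne] at h1
  exact (ENNReal.ofReal_le_ofReal_iff (abs_nonneg _)).1 h1

/-- Determinant bound for the differential of the expansion of a tube along its normals. -/
theorem ContinuousLinearMap.pow_le_abs_det_smul_sub {E : Type*} [NormedAddCommGroup E]
    [InnerProductSpace ℝ E] [FiniteDimensional ℝ E] (A : E →L[ℝ] E) {c : ℝ} (hc : 1 ≤ c) {d : ℕ}
    (hd : Module.finrank ℝ A.range ≤ d) (hdE : d ≤ Module.finrank ℝ E)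
    (hA : ∀ w, c * (‖A w‖ ^ 2 - inner ℝ (A w) w) ≤ ‖A w‖ ^ 2 / 4) :
    (1 / 2 : ℝ) ^ d * c ^ (Module.finrank ℝ E - d)
      ≤ |(c • (1 : E →L[ℝ] E) - (c - 1) • A).det| := by
  set B : E →L[ℝ] E := c • (1 : E →L[ℝ] E) - (c - 1) • A with hB
  have hBw : ∀ w, B w = c • w - (c - 1) • A w := fun w => rfl
  let W : Submodule ℝ E := A.range
  have hBnorm : ∀ w, 1 / 2 * ‖w‖ ≤ ‖B w‖ := by
    intro w
    have h1 : B w = A w + c • (w - A w) := by rw [hBw, sub_smul, smul_sub, one_smul]; abel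
    have h2 : ‖B w‖ ^ 2 = ‖A w‖ ^ 2 + 2 * (c * (inner ℝ (A w) w - ‖A w‖ ^ 2))
        + c ^ 2 * ‖w - A w‖ ^ 2 := by
      rw [h1, norm_add_sq_real, inner_smul_right, norm_smul, inner_sub_right,
        real_inner_self_eq_norm_sq, mul_pow, Real.norm_eq_abs, sq_abs]
    have h3 : ‖w‖ ^ 2 ≤ 2 * ‖A w‖ ^ 2 + 2 * ‖w - A w‖ ^ 2 := by
      have h4 : ‖w‖ ≤ ‖A w‖ + ‖w - A w‖ := by
        simpa using norm_add_le (A w) (w - A w)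
      nlinarith [sq_nonneg (‖A w‖ - ‖w - A w‖), norm_nonneg w]
    have h5 : ‖w - A w‖ ^ 2 ≤ c ^ 2 * ‖w - A w‖ ^ 2 := by
      exact le_mul_of_one_le_left (sq_nonneg _) (one_le_pow₀ hc)
    have h6 := hA w
    refine le_of_sq_le_sq ?_ (norm_nonneg _)
    nlinarith
  have hW : W ≤ W.comap (B : E →ₗ[ℝ] E) := by
    intro w hw
    refine W.sub_mem (W.smul_mem _ hw) (W.smul_mem _ ⟨w, rfl⟩)
  have hdet : B.det = LinearMap.det ((B : E →ₗ[ℝ] E).restrict hW) *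
      LinearMap.det (W.mapQ W (B : E →ₗ[ℝ] E) hW) := LinearMap.det_eq_det_mul_det W _ hW
  have hQ : W.mapQ W (B : E →ₗ[ℝ] E) hW = c • LinearMap.id := by
    ext w
    have : (B : E →ₗ[ℝ] E) w = c • w - (c - 1) • A w := rfl
    simp only [LinearMap.comp_apply, Submodule.mkQ_apply, Submodule.mapQ_apply,
      LinearMap.smul_apply, LinearMap.id_apply, this]
    rw [← Submodule.Quotient.mk_smul, Submodule.Quotient.eq, sub_sub_cancel_left]
    exact W.neg_mem (W.smul_mem _ ⟨w, rfl⟩)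
  have h1 : (1 / 2 : ℝ) ^ Module.finrank ℝ W ≤
      |LinearMap.det ((B : E →ₗ[ℝ] E).restrict hW)| :=
    LinearMap.pow_finrank_le_abs_det _ (by norm_num) fun w => hBnorm w
  rw [hdet, abs_mul, hQ, LinearMap.det_smul, LinearMap.det_id, mul_one,
    abs_of_nonneg (by positivity : (0 : ℝ) ≤ c ^ Module.finrank ℝ (E ⧸ W))]
  have hk := Submodule.finrank_quotient_add_finrank W
  gcongr
  · exact (pow_le_pow_of_le_one (by norm_num) (by norm_num) hd).trans h1
  · change Module.finrank ℝ W ≤ d at hd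
    omega

section Projection

variable {E : Type*} [NormedAddCommGroup E] [InnerProductSpace ℝ E] [FiniteDimensional ℝ E]

theorem IsNearestPointMap.lipschitzOnWith {M : Set E} {π : E → E}
    (hπ : IsNearestPointMap M π) (hM : IsCompact M) {τ : ℝ} (hτ : 0 < τ) (hr : HasReachGE M τ)
    {ε : ℝ} (hε : ε < τ) :
    LipschitzOnWith (τ / (τ - ε)).toNNReal π {x | infDist x M ≤ ε} := by
  refine LipschitzOnWith.of_dist_le_mul fun x hx y hy => ?_
  have h1 := hπ.mul_norm_sq_le_inner hM hτ hr hx hy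
  have h0 : 0 < τ - ε := by linarith
  have h2 := real_inner_le_norm (π x - π y) (x - y)
  rw [Real.coe_toNNReal _ (by positivity), dist_eq_norm, dist_eq_norm, div_mul_eq_mul_div,
    le_div_iff₀ h0]
  rcases (norm_nonneg (π x - π y)).eq_or_lt with h | h
  · rw [← h]; simp only [zero_mul]; positivity
  · refine le_of_mul_le_mul_right ?_ h
    nlinarith

theorem IsNearestPointMap.mul_norm_sq_fderiv_le {M : Set E} {π : E → E}
    (hπ : IsNearestPointMap M π) (hM : IsCompact M) {τ : ℝ} (hτ : 0 < τ) (hr : HasReachGE M τ)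
    {ε : ℝ} {x : E} (hx : infDist x M < ε) {A : E →L[ℝ] E} (hA : HasFDerivAt π A x) (w : E) :
    (τ - ε) * ‖A w‖ ^ 2 ≤ τ * inner ℝ (A w) w := by
  have h1 := (hA.hasLineDerivAt w).tendsto_slope_zero
  have hev : ∀ᶠ t : ℝ in 𝓝[≠] 0, infDist (x + t • w) M < ε := by
    have : ContinuousAt (fun t : ℝ => infDist (x + t • w) M) 0 :=
      ((continuous_infDist_pt M).comp (by fun_prop : Continuous fun t : ℝ => x + t • w)).continuousAt
    exact nhdsWithin_le_nhds (this.eventually_lt_const (by simpa using hx))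
  have h2 : Tendsto (fun t : ℝ => (τ - ε) * ‖t⁻¹ • (π (x + t • w) - π x)‖ ^ 2) (𝓝[≠] 0)
      (𝓝 ((τ - ε) * ‖A w‖ ^ 2)) := (h1.norm.pow 2).const_mul _
  have h3 : Tendsto (fun t : ℝ => τ * inner ℝ (t⁻¹ • (π (x + t • w) - π x)) w) (𝓝[≠] 0)
      (𝓝 (τ * inner ℝ (A w) w)) := (h1.inner tendsto_const_nhds).const_mul _
  refine le_of_tendsto_of_tendsto h2 h3 ?_
  filter_upwards [hev, self_mem_nhdsWithin] with t ht ht0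
  have h4 := hπ.mul_norm_sq_le_inner hM hτ hr ht.le hx.le
  rw [add_sub_cancel_left, inner_smul_right] at h4
  rw [norm_smul, inner_smul_left, mul_pow, norm_inv, Real.norm_eq_abs, inv_pow, sq_abs]
  simp only [conj_trivial]
  have ht2 : 0 < t ^ 2 := by have : t ≠ 0 := ht0; positivity
  have ht1 : t ≠ 0 := ht0
  calc _ = (t ^ 2)⁻¹ * ((τ - ε) * ‖π (x + t • w) - π x‖ ^ 2) := by ring
    _ ≤ (t ^ 2)⁻¹ * (τ * (t * inner ℝ (π (x + t • w) - π x) w)) := by gcongr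
    _ = _ := by field_simp

/-- The differential of the nearest point map of a `d`-manifold has rank at most `d`. -/
theorem IsNearestPointMap.finrank_range_fderiv_le {M : Set E} {π : E → E}
    (hπ : IsNearestPointMap M π) {d : ℕ} (hd : 1 ≤ d) (hM : IsCompactTopManifoldWithBoundary d M)
    {τ : ℝ} (hr : HasReachGE M τ) {x : E} (hx : infDist x M < τ) {A : E →L[ℝ] E}
    (hA : HasFDerivAt π A x) : Module.finrank ℝ A.range ≤ d := by
  obtain ⟨U, hU, hpU, V, -, ⟨e⟩⟩ := hM.2 ⟨π x, hπ.mem x⟩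
  obtain ⟨O, hO, rfl⟩ := isOpen_induced_iff.1 hU
  let j : (Subtype.val ⁻¹' O : Set M) → E := fun u => u.1.1
  have hj : IsEmbedding j := IsEmbedding.subtypeVal.comp IsEmbedding.subtypeVal
  have hjr : range j = M ∩ O := by
    ext y
    constructor
    · rintro ⟨u, rfl⟩
      exact ⟨u.1.2, u.2⟩
    · rintro ⟨h1, h2⟩
      exact ⟨⟨⟨y, h1⟩, h2⟩, rfl⟩
  let i : V → ℝ × EuclideanSpace ℝ (Fin (d - 1)) := fun v => v.1.1
  have hi : IsEmbedding i := IsEmbedding.subtypeVal.comp IsEmbedding.subtypeVal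
  let c : E → ℝ × EuclideanSpace ℝ (Fin (d - 1)) := Function.extend j (i ∘ e) 0
  let c' : ℝ × EuclideanSpace ℝ (Fin (d - 1)) → E := Function.extend i (j ∘ e.symm) 0
  have hc : ContinuousOn c (range j) :=
    hj.continuousOn_extend (hi.continuous.comp e.continuous) 0
  have hc' : ContinuousOn c' (range i) :=
    hi.continuousOn_extend (hj.continuous.comp e.symm.continuous) 0
  have hcj : ∀ u, c (j u) = i (e u) := fun u => hj.injective.extend_apply _ _ _
  have hc'i : ∀ v, c' (i v) = j (e.symm v) := fun v => hi.injective.extend_apply _ _ _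
  have hmaps : MapsTo c (range j) (range i) := by
    rintro _ ⟨u, rfl⟩
    exact ⟨e u, (hcj u).symm⟩
  have hinv : ∀ y ∈ range j, c' (c y) = y := by
    rintro _ ⟨u, rfl⟩
    rw [hcj, hc'i, e.symm_apply_apply]
  let W : Submodule ℝ E := A.range
  obtain ⟨σ, hσ⟩ := LinearMap.exists_rightInverse_of_surjective (A : E →ₗ[ℝ] E).rangeRestrict
    (LinearMap.range_rangeRestrict _)
  let σ' : W →L[ℝ] E := LinearMap.toContinuousLinearMap σ
  have hσ' : ∀ w : W, A (σ' w) = w := fun w => congrArg Subtype.val (LinearMap.congr_fun hσ w)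
  let P : E →L[ℝ] W := W.orthogonalProjectionOnto
  have hxσ : x = x + σ' 0 := by simp
  have hder : HasFDerivAt (fun w : W => P (π (x + σ' w) - π x)) (ContinuousLinearMap.id ℝ W) 0 := by
    have h1 : HasFDerivAt (fun w : W => x + σ' w) σ' 0 := σ'.hasFDerivAt.const_add x
    have h2 : HasFDerivAt (fun w : W => π (x + σ' w)) (A.comp σ') 0 := by
      rw [hxσ] at hA
      exact hA.comp (0 : W) h1
    have h3 := P.hasFDerivAt.comp (0 : W) (h2.sub_const (π x))
    refine h3.congr_fderiv ?_
    ext1 w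
    simp only [ContinuousLinearMap.comp_apply, hσ', ContinuousLinearMap.id_apply]
    exact Submodule.orthogonalProjectionOnto_mem_subspace_eq_self w
  have hev1 : ∀ᶠ w : W in 𝓝 0, ‖P (π (x + σ' w) - π x) - w‖ ≤ 1 / 4 * ‖w‖ := by
    have := hder.isLittleO.def (by norm_num : (0 : ℝ) < 1 / 4)
    simpa using this
  have hcont0 : ∀ w : W, infDist (x + σ' w) M < τ → ContinuousAt (fun w : W => π (x + σ' w)) w :=
    fun w hw => ContinuousAt.comp (f := fun w : W => x + σ' w) (g := π)
      (hπ.continuousAt hM.1 hr hw) (by fun_prop)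
  have hev2 : ∀ᶠ w : W in 𝓝 0, infDist (x + σ' w) M < τ := by
    have : Continuous fun w : W => infDist (x + σ' w) M :=
      (continuous_infDist_pt M).comp (by fun_prop)
    exact this.continuousAt.eventually_lt_const (by simpa using hx)
  have hev3 : ∀ᶠ w : W in 𝓝 0, π (x + σ' w) ∈ O :=
    (hcont0 0 (by rwa [← hxσ])).eventually_mem (hO.mem_nhds (by rw [← hxσ]; exact hpU))
  obtain ⟨δ, hδ, hball⟩ := nhds_basis_closedBall.eventually_iff.1 (hev1.and (hev2.and hev3))
  have hmem : ∀ w ∈ closedBall (0 : W) δ, π (x + σ' w) ∈ range j := fun w hw => by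
    rw [hjr]; exact ⟨hπ.mem _, (hball hw).2.2⟩
  have hu : ContinuousOn (fun w : W => c (π (x + σ' w))) (closedBall 0 δ) :=
    hc.comp (fun w hw => (hcont0 w (hball hw).2.1).continuousWithinAt) hmem
  have hh : ContinuousOn (fun y => P (c' y - π x))
      ((fun w : W => c (π (x + σ' w))) '' closedBall 0 δ) := by
    refine P.continuous.comp_continuousOn (ContinuousOn.sub (hc'.mono ?_) continuousOn_const)
    rintro _ ⟨w, hw, rfl⟩
    exact hmaps (hmem w hw)
  have hfin := finrank_le_of_norm_comp_sub_le hδ hu hh fun w hw => by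
    simp only [hinv _ (hmem w hw)]
    refine ((hball hw).1).trans ?_
    rw [mem_closedBall_zero_iff] at hw
    linarith
  rw [Module.finrank_prod, Module.finrank_self, finrank_euclideanSpace_fin] at hfin
  change Module.finrank ℝ W ≤ d
  omega

end Projection

theorem IsCompact.exists_finset_pairwiseDisjoint_ball_subset {X : Type*} [MetricSpace X]
    {A : Set X} (hA : IsCompact A) {δ : ℝ} (hδ : 0 < δ) :
    ∃ T : Finset X, ↑T ⊆ A ∧ (T : Set X).PairwiseDisjoint (fun x => ball x δ) ∧
      A ⊆ ⋃ x : T, closedBall (x : X) (2 * δ) := by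
  lift δ to NNReal using hδ.le
  have hδ0 : δ ≠ 0 := by rintro rfl; simp at hδ
  have hfin : packingNumber (2 * δ) A ≠ ⊤ := by
    obtain ⟨N, -, hN, hcov⟩ := exists_finite_isCover_of_isCompact hδ0 hA
    refine ne_top_of_le_ne_top ?_ ((packingNumber_two_mul_le_externalCoveringNumber δ A).trans
      (hcov.externalCoveringNumber_le_encard))
    exact hN.encard_lt_top.ne
  have hT : (maximalSeparatedSet (2 * δ) A).Finite := by
    rw [← Set.encard_lt_top_iff, encard_maximalSeparatedSet hfin]
    exact lt_top_iff_ne_top.2 hfin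
  refine ⟨hT.toFinset, by simpa using maximalSeparatedSet_subset, ?_, ?_⟩
  · rw [hT.coe_toFinset]
    intro x hx y hy hxy
    have h : ((2 * δ : NNReal) : ENNReal) < edist x y :=
      isSeparated_maximalSeparatedSet hx hy hxy
    refine ball_disjoint_ball ?_
    rw [edist_nndist, ENNReal.coe_lt_coe] at h
    have h2 : ((2 * δ : NNReal) : ℝ) < nndist x y := h
    rw [coe_nndist] at h2
    push_cast at h2
    linarith
  · have h := isCover_iff_subset_iUnion_closedBall.1 (isCover_maximalSeparatedSet hfin)
    refine h.trans ?_
    intro y hy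
    simp only [mem_iUnion, exists_prop] at hy ⊢
    obtain ⟨x, hx, hy⟩ := hy
    exact ⟨⟨x, by simpa using hx⟩, by simpa using hy⟩

section Volume

variable {E : Type*} [NormedAddCommGroup E] [InnerProductSpace ℝ E] [FiniteDimensional ℝ E]

/-- Expanding a thin tube along its normals bounds the volume of the tube. -/
theorem IsNearestPointMap.mul_measure_tube_le [MeasurableSpace E] [BorelSpace E] (μ : Measure E)
    [μ.IsAddHaarMeasure] {M : Set E} {π : E → E} (hπ : IsNearestPointMap M π) {d : ℕ} (hd : 1 ≤ d)
    (hdE : d ≤ Module.finrank ℝ E) (hM : IsCompactTopManifoldWithBoundary d M) {τ : ℝ}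
    (hr : HasReachGE M τ) {ε c : ℝ} (hε : 0 < ε) (hc : 1 ≤ c) (hcε : c * ε ≤ τ / 4) (x₀ : E)
    (R : ℝ) :
    ENNReal.ofReal ((1 / 2) ^ d * c ^ (Module.finrank ℝ E - d)) *
        μ (ball x₀ R ∩ {x | infDist x M < ε}) ≤ μ (ball x₀ (R + c * ε)) := by
  have hετ : ε ≤ τ / 4 := by nlinarith
  have hτ : 0 < τ := by linarith
  set S := ball x₀ R ∩ {x | infDist x M < ε} with hS
  have hSo : IsOpen S := isOpen_ball.inter (isOpen_lt (continuous_infDist_pt M) continuous_const)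
  set D := {x | DifferentiableAt ℝ π x}
  have hD : MeasurableSet D := measurableSet_of_differentiableAt ℝ π
  have hlip : LipschitzOnWith (τ / (τ - ε)).toNNReal π S :=
    (hπ.lipschitzOnWith hM.1 hτ hr (by linarith : ε < τ)).mono fun x hx =>
      (show infDist x M < ε from hx.2).le
  have hae : S ≤ᵐ[μ] (S ∩ D : Set E) := by
    filter_upwards [hlip.ae_differentiableWithinAt_of_mem (μ := μ)] with x hx hxS
    exact ⟨hxS, (hx hxS).differentiableAt (hSo.mem_nhds hxS)⟩
  let Φ : E → E := fun x => π x + c • (x - π x)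
  let Φ' : E → E →L[ℝ] E := fun x => c • (1 : E →L[ℝ] E) - (c - 1) • fderiv ℝ π x
  have hΦ' : ∀ x ∈ S ∩ D, HasFDerivWithinAt Φ (Φ' x) (S ∩ D) x := by
    intro x hx
    have h1 : HasFDerivAt π (fderiv ℝ π x) x := DifferentiableAt.hasFDerivAt hx.2
    have h2 := h1.add (((hasFDerivAt_id x).sub h1).const_smul c)
    refine (h2.congr_fderiv ?_).hasFDerivWithinAt
    ext w
    simp [Φ', sub_smul, smul_sub]
    abel
  have hcx : ∀ x ∈ S, c * infDist x M < τ := by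
    intro x hx
    have : infDist x M < ε := hx.2
    nlinarith
  have hinj : InjOn Φ (S ∩ D) := by
    intro x hx y hy hxy
    have hx1 := hπ.apply_add_smul_sub hM.1 hr (by linarith : 0 ≤ c) (hcx x hx.1)
    have hy1 := hπ.apply_add_smul_sub hM.1 hr (by linarith : 0 ≤ c) (hcx y hy.1)
    have h2 : π x = π y := by rw [← hx1, ← hy1]; exact congrArg π hxy
    simp only [Φ, h2, add_right_inj] at hxy
    have h3 := smul_right_injective E (by linarith : c ≠ 0) hxy
    exact sub_left_injective h3
  have hdet : ∀ x ∈ S ∩ D, ENNReal.ofReal ((1 / 2) ^ d * c ^ (Module.finrank ℝ E - d)) ≤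
      ENNReal.ofReal |(Φ' x).det| := by
    intro x hx
    have h1 : HasFDerivAt π (fderiv ℝ π x) x := DifferentiableAt.hasFDerivAt hx.2
    have hxε : infDist x M < ε := hx.1.2
    refine ENNReal.ofReal_le_ofReal ((fderiv ℝ π x).pow_le_abs_det_smul_sub hc
      (hπ.finrank_range_fderiv_le hd hM hr (by linarith) h1) hdE fun w => ?_)
    have h2 := hπ.mul_norm_sq_fderiv_le hM.1 hτ hr hxε h1 w
    set a := ‖fderiv ℝ π x w‖ ^ 2
    have ha : 0 ≤ a := sq_nonneg _
    set b := inner ℝ (fderiv ℝ π x w) w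
    have h3 : τ * (a - b) ≤ ε * a := by linarith
    have h4 : c * (τ * (a - b)) ≤ c * (ε * a) := by gcongr
    have h5 : c * ε * a ≤ τ / 4 * a := by gcongr
    refine le_of_mul_le_mul_left ?_ hτ
    linarith
  have himg : Φ '' (S ∩ D) ⊆ ball x₀ (R + c * ε) := by
    rintro _ ⟨x, hx, rfl⟩
    have h1 : dist (Φ x) x = (c - 1) * infDist x M := by
      have : Φ x - x = (c - 1) • (x - π x) := by
        simp only [Φ, sub_smul, one_smul]; abel
      rw [dist_eq_norm, this, norm_smul, ← dist_eq_norm x, hπ.dist_eq, Real.norm_eq_abs,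
        abs_of_nonneg (by linarith)]
    have h2 : dist x x₀ < R := hx.1.1
    have h3 : infDist x M < ε := hx.1.2
    have h4 := dist_triangle (Φ x) x x₀
    rw [mem_ball]
    nlinarith [infDist_nonneg (x := x) (s := M)]
  calc _ ≤ ENNReal.ofReal ((1 / 2) ^ d * c ^ (Module.finrank ℝ E - d)) * μ (S ∩ D) := by
        exact mul_le_mul_right (measure_mono_ae hae) _
    _ = ∫⁻ _ in S ∩ D, ENNReal.ofReal ((1 / 2) ^ d * c ^ (Module.finrank ℝ E - d)) ∂μ := by
        rw [setLIntegral_const]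
    _ ≤ ∫⁻ x in S ∩ D, ENNReal.ofReal |(Φ' x).det| ∂μ :=
        setLIntegral_mono' (hSo.measurableSet.inter hD) hdet
    _ = μ (Φ '' (S ∩ D)) :=
        lintegral_abs_det_fderiv_eq_addHaar_image μ (hSo.measurableSet.inter hD) hΦ' hinj
    _ ≤ _ := measure_mono himg

theorem card_mul_pow_le_of_pairwiseDisjoint_ball {d : ℕ} (hd : 1 ≤ d)
    (hdE : d ≤ Module.finrank ℝ E) {M : Set E} (hM : IsCompactTopManifoldWithBoundary d M) {τ : ℝ}
    (hr : HasReachGE M τ) {x₀ : E} {s r ε : ℝ} (hε : 0 < ε) (hεr : ε ≤ r) (hrs : r ≤ s)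
    (hrτ : r ≤ τ / 4) {T : Finset E} (hT : ↑T ⊆ M ∩ closedBall x₀ s)
    (hdisj : (T : Set E).PairwiseDisjoint (fun x => ball x (ε / 2))) :
    T.card * ε ^ d * r ^ (Module.finrank ℝ E - d) ≤ 12 ^ Module.finrank ℝ E *
      s ^ Module.finrank ℝ E := by
  rcases T.eq_empty_or_nonempty with rfl | ⟨a₀, ha₀⟩
  · simp only [Finset.card_empty, Nat.cast_zero, zero_mul]
    have : 0 ≤ s := by linarith
    positivity
  obtain ⟨π, hπ⟩ := hM.1.exists_isNearestPointMap ⟨a₀, (hT ha₀).1⟩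
  borelize E
  let μ : Measure E := Measure.addHaar
  set n := Module.finrank ℝ E
  have hr0 : 0 < r := by linarith
  have h1 := hπ.mul_measure_tube_le μ hd hdE hM hr hε (by rwa [one_le_div hε] : 1 ≤ r / ε)
    (by rwa [div_mul_cancel₀ _ hε.ne']) x₀ (s + ε)
  rw [div_mul_cancel₀ _ hε.ne'] at h1
  have hsub : (⋃ a ∈ T, ball a (ε / 2)) ⊆ ball x₀ (s + ε) ∩ {x | infDist x M < ε} := by
    intro y hy
    simp only [mem_iUnion, exists_prop] at hy
    obtain ⟨a, ha, hy⟩ := hy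
    have haM := hT ha
    have h2 : dist a x₀ ≤ s := haM.2
    rw [mem_ball] at hy
    refine ⟨?_, ?_⟩
    · rw [mem_ball]
      have := dist_triangle y a x₀
      linarith
    · have := infDist_le_dist_of_mem (x := y) haM.1
      change infDist y M < ε
      linarith
  have h2 : (T.card : ENNReal) * (ENNReal.ofReal ((ε / 2) ^ n) * μ (ball 0 1)) ≤
      μ (ball x₀ (s + ε) ∩ {x | infDist x M < ε}) := by
    refine le_trans (le_of_eq ?_) (measure_mono hsub)
    rw [measure_biUnion_finset hdisj fun _ _ => measurableSet_ball]
    simp only [Measure.addHaar_ball_of_pos μ _ (by positivity : 0 < ε / 2)]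
    rw [Finset.sum_const, nsmul_eq_mul]
  have h3 : μ (ball x₀ (s + ε + r)) ≤ ENNReal.ofReal ((3 * s) ^ n) * μ (ball 0 1) := by
    rw [← Measure.addHaar_ball_of_pos μ x₀ (by linarith : 0 < 3 * s)]
    exact measure_mono (ball_subset_ball (by linarith))
  have h4 : ENNReal.ofReal ((1 / 2) ^ d * (r / ε) ^ (n - d) * (T.card * (ε / 2) ^ n)) *
      μ (ball 0 1) ≤ ENNReal.ofReal ((3 * s) ^ n) * μ (ball 0 1) := by
    refine le_trans (le_of_eq ?_) (((mul_le_mul_right h2 _).trans h1).trans h3)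
    rw [ENNReal.ofReal_mul (by positivity), ENNReal.ofReal_mul (by positivity : (0:ℝ) ≤ T.card),
      ENNReal.ofReal_natCast]
    ring
  rw [ENNReal.mul_le_mul_iff_left (measure_ball_pos μ _ one_pos).ne' measure_ball_lt_top.ne,
    ENNReal.ofReal_le_ofReal_iff (pow_nonneg (by linarith) _)] at h4
  have h5 : (1 / 2) ^ d * (r / ε) ^ (n - d) * (T.card * (ε / 2) ^ n) =
      (1 / 2) ^ d * (1 / 2) ^ n * (T.card * ε ^ d * r ^ (n - d)) := by
    have : ε ^ n = ε ^ (n - d) * ε ^ d := by rw [← pow_add, Nat.sub_add_cancel hdE]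
    rw [div_pow r, div_pow ε, this, one_div_pow 2 n]
    field_simp
  rw [h5] at h4
  have h6 : (1 / 4 : ℝ) ^ n ≤ (1 / 2) ^ d * (1 / 2) ^ n := by
    rw [show (1 / 4 : ℝ) = 1 / 2 * (1 / 2) by norm_num, mul_pow]
    gcongr ?_ * _
    exact pow_le_pow_of_le_one (by norm_num) (by norm_num) hdE
  have h7 : (1 / 4 : ℝ) ^ n * (T.card * ε ^ d * r ^ (n - d)) ≤ (3 * s) ^ n :=
    le_trans (by gcongr) h4
  calc (T.card * ε ^ d * r ^ (n - d) : ℝ)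
      = 4 ^ n * ((1 / 4 : ℝ) ^ n * (T.card * ε ^ d * r ^ (n - d))) := by
        rw [← mul_assoc, ← mul_pow]; norm_num
    _ ≤ 4 ^ n * (3 * s) ^ n := by gcongr
    _ = 12 ^ n * s ^ n := by rw [← mul_pow, ← mul_pow]; ring

theorem hausdorffMeasure_inter_closedBall_le_of_reach [MeasurableSpace E] [BorelSpace E] {d : ℕ}
    (hd : 1 ≤ d) (hdE : d ≤ Module.finrank ℝ E) {M : Set E}
    (hM : IsCompactTopManifoldWithBoundary d M) {τ : ℝ} (hr : HasReachGE M τ) (x₀ : E) {s r : ℝ}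
    (hr0 : 0 < r) (hrs : r ≤ s) (hrτ : r ≤ τ / 4) :
    μH[(d : ℝ)] (M ∩ closedBall x₀ s) ≤ ENNReal.ofReal
      (24 ^ Module.finrank ℝ E * s ^ Module.finrank ℝ E / r ^ (Module.finrank ℝ E - d)) := by
  set n := Module.finrank ℝ E
  let ε : ℕ → ℝ := fun k => r / (k + 1)
  have hε : ∀ k, 0 < ε k := fun k => by positivity
  have hεr : ∀ k, ε k ≤ r := fun k => div_le_self hr0.le (by linarith [k.cast_nonneg (α := ℝ)])
  have hA : IsCompact (M ∩ closedBall x₀ s) := hM.1.inter_right isClosed_closedBall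
  choose T hTA hTd hTc using fun k =>
    hA.exists_finset_pairwiseDisjoint_ball_subset (by have := hε k; positivity : 0 < ε k / 2)
  have hlim : Tendsto (fun k => ENNReal.ofReal (2 * ε k)) atTop (𝓝 0) := by
    have h1 : Tendsto ε atTop (𝓝 0) := by
      simpa [ε, div_eq_mul_inv] using (tendsto_one_div_add_atTop_nhds_zero_nat (𝕜 := ℝ)).const_mul r
    have h2 := ENNReal.tendsto_ofReal (h1.const_mul 2)
    simpa using h2
  have hdiam : ∀ k (a : T k), ediam (closedBall (a : E) (2 * (ε k / 2))) ≤
      ENNReal.ofReal (2 * ε k) := by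
    intro k a
    rw [mul_div_cancel₀ _ two_ne_zero]
    rw [← closedEBall_ofReal (hε k).le]
    refine ediam_closedEBall_le.trans (le_of_eq ?_)
    rw [ENNReal.ofReal_mul two_pos.le, ENNReal.ofReal_ofNat]
  have hH := Measure.hausdorffMeasure_le_liminf_sum (d : ℝ) (M ∩ closedBall x₀ s) _ hlim
    (fun k (a : T k) => closedBall (a : E) (2 * (ε k / 2))) (Eventually.of_forall hdiam)
    (Eventually.of_forall hTc)
  refine hH.trans (liminf_le_of_le ?_ ?_)
  · isBoundedDefault
  intro b hb
  obtain ⟨k, hk⟩ := hb.exists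
  refine hk.trans ?_
  calc ∑ a : T k, ediam (closedBall (a : E) (2 * (ε k / 2))) ^ (d : ℝ)
      ≤ ∑ a : T k, ENNReal.ofReal (2 * ε k) ^ (d : ℝ) := by
        gcongr with a
        exact hdiam k a
    _ = ENNReal.ofReal ((T k).card * (2 * ε k) ^ d) := by
        rw [Finset.sum_const, nsmul_eq_mul, Finset.card_univ, Fintype.card_coe, ENNReal.rpow_natCast,
          ENNReal.ofReal_mul (Nat.cast_nonneg _), ENNReal.ofReal_natCast,
          ENNReal.ofReal_pow (by have := hε k; positivity)]
    _ ≤ _ := by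
        refine ENNReal.ofReal_le_ofReal ?_
        rw [le_div_iff₀ (by positivity)]
        have h1 := card_mul_pow_le_of_pairwiseDisjoint_ball hd hdE hM hr (hε k) (hεr k) hrs hrτ
          (hTA k) (hTd k)
        have h2 : (2 : ℝ) ^ d ≤ 2 ^ n := pow_le_pow_right₀ (by norm_num) hdE
        have h3 := hε k
        calc (T k).card * (2 * ε k) ^ d * r ^ (n - d)
            = 2 ^ d * ((T k).card * ε k ^ d * r ^ (n - d)) := by rw [mul_pow]; ring
          _ ≤ 2 ^ n * (12 ^ n * s ^ n) := by gcongr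
          _ = 24 ^ n * s ^ n := by rw [← mul_assoc, ← mul_pow]; norm_num

end Volume

theorem norm_le_of_mem_cube {m : ℕ} (hm : 1 ≤ m) {K : ℝ} (hK : 0 ≤ K)
    {x : EuclideanSpace ℝ (Fin m)} (hx : x ∈ cube m K) : ‖x‖ ≤ m * K := by
  have hm' : (1 : ℝ) ≤ m := by exact_mod_cast hm
  refine le_of_sq_le_sq ?_ (by positivity)
  rw [EuclideanSpace.norm_sq_eq]
  calc ∑ i, ‖x i‖ ^ 2 ≤ ∑ _i : Fin m, K ^ 2 := by
        gcongr with i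
        exact hx i
    _ = m * K ^ 2 := by simp
    _ ≤ m * (m * K ^ 2) := le_mul_of_one_le_left (by positivity) hm'
    _ = (m * K) ^ 2 := by ring

/-- Local Hausdorff-measure bound for a manifold with reach bounded below
(inequality (proof.upper.volume.bound) in the proof of Claim B.1): there is a
constant `C > 0` depending only on `K_I, d, m` such that for every `τ_g > 0`,
every compact `d`-manifold `M ⊆ [-K_I,K_I]^m` with reach `≥ τ_g`, every
`x ∈ ℝ^m` and every `s > 0`,
`H^d(M ∩ closedBall x s) ≤ C (1 + τ_g^{d-m}) s^d`. -/
theorem hausdorff_local_volume_bound_of_reach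
    (m d : ℕ) (KI : ℝ)
    (hd : 1 ≤ d) (hdm : d ≤ m) (hKI : 1 ≤ KI) :
    ∃ C : ℝ, 0 < C ∧
      ∀ τg : ℝ, 0 < τg →
        ∀ M : Set (EuclideanSpace ℝ (Fin m)),
          IsCompactTopManifoldWithBoundary d M → M ⊆ cube m KI →
          HasReachGE M τg →
          ∀ (x : EuclideanSpace ℝ (Fin m)) (s : ℝ), 0 < s →
            μH[(d : ℝ)] (M ∩ Metric.closedBall x s) ≤
              ENNReal.ofReal (C * (1 + τg ^ ((d : ℤ) - m)) * s ^ d) := by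
  have hm : (1 : ℝ) ≤ m := by exact_mod_cast hd.trans hdm
  set K : ℝ := m * KI with hK
  have hK1 : 1 ≤ K := one_le_mul_of_one_le_of_one_le hm hKI
  refine ⟨24 ^ m * (4 * K) ^ (m - d), by positivity, fun τ hτ M hM hMK hr x s hs => ?_⟩
  obtain ⟨x₀, s', hs'0, hs's, hs'K, hsub⟩ : ∃ (x₀ : EuclideanSpace ℝ (Fin m)) (s' : ℝ), 0 < s' ∧
      s' ≤ s ∧ s' ≤ K ∧ M ∩ closedBall x s ⊆ M ∩ closedBall x₀ s' := by
    rcases le_total s K with h | h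
    · exact ⟨x, s, hs, le_rfl, h, le_rfl⟩
    · refine ⟨0, K, by linarith, h, le_rfl, fun y hy => ⟨hy.1, ?_⟩⟩
      rw [mem_closedBall_zero_iff]
      exact norm_le_of_mem_cube (hd.trans hdm) (by linarith) (hMK hy.1)
  have hr0 : 0 < min s' (τ / 4) := lt_min hs'0 (by positivity)
  have h1 := hausdorffMeasure_inter_closedBall_le_of_reach hd
    (by rwa [finrank_euclideanSpace_fin]) hM hr x₀ hr0 (min_le_left _ _) (min_le_right _ _)
  rw [finrank_euclideanSpace_fin] at h1
  refine (measure_mono hsub).trans (h1.trans (ENNReal.ofReal_le_ofReal ?_))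
  have hz : τ ^ ((d : ℤ) - m) = (τ ^ (m - d))⁻¹ := by
    rw [← zpow_natCast, ← zpow_neg, Nat.cast_sub hdm, neg_sub]
  have h4K : 1 ≤ (4 * K) ^ (m - d) := one_le_pow₀ (by linarith)
  have h2 : s' ^ (m - d) / min s' (τ / 4) ^ (m - d) ≤
      (4 * K) ^ (m - d) * (1 + τ ^ ((d : ℤ) - m)) := by
    rw [hz]
    have hτ' : 0 ≤ (τ ^ (m - d))⁻¹ := by positivity
    rcases min_choice s' (τ / 4) with h | h <;> rw [h]
    · rw [div_self (by positivity)]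
      exact one_le_mul_of_one_le_of_one_le h4K (by linarith)
    · calc s' ^ (m - d) / (τ / 4) ^ (m - d) ≤ K ^ (m - d) / (τ / 4) ^ (m - d) := by gcongr
        _ = (4 * K) ^ (m - d) * (τ ^ (m - d))⁻¹ := by
          rw [← div_pow, ← inv_pow, ← mul_pow]
          congr 1
          field_simp
        _ ≤ _ := by gcongr; linarith
  calc 24 ^ m * s' ^ m / min s' (τ / 4) ^ (m - d)
      = 24 ^ m * (s' ^ (m - d) / min s' (τ / 4) ^ (m - d)) * s' ^ d := by
        rw [← Nat.sub_add_cancel hdm, pow_add s']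
        simp only [Nat.add_sub_cancel]
        ring
    _ ≤ 24 ^ m * ((4 * K) ^ (m - d) * (1 + τ ^ ((d : ℤ) - m))) * s ^ d := by
        have : 0 ≤ τ ^ ((d : ℤ) - m) := by positivity
        gcongr
    _ = _ := by ring

end
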